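/- arXiv:1512.07815 — 4 statements merged into one kernel-verified Lean document; each statement's English description precedes it below -/
import Mathlib

section
/- The function δ is submodular: for all integers y_a, y_b with 0 ≤ y_a ≤ h'−1 and 0 ≤ y_b ≤ h'−1, one has δ(y_a, y_b) + δ(y_a+1, y_b+1) ≤ δ(y_a+1, y_b) + δ(y_a, y_b+1). -/
/-- The pairwise overestimate `δ` from the range expansion graph construction. -/
noncomputable def tmcmDelta (d : ℤ → ℝ) (M : ℝ) (xa xb : ℤ) (ya yb : ℤ) : ℝ :=
  if ya = 0 then
    (if yb = 0 then min (d (xa - xb)) M else M + d (yb - 1))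
  else
    (if yb = 0 then M + d (ya - 1) else d (ya - yb))

/-- `δ` is submodular: for all `y_a, y_b` with `0 ≤ y_a ≤ h' - 1` and
`0 ≤ y_b ≤ h' - 1`,
`δ(y_a, y_b) + δ(y_a+1, y_b+1) ≤ δ(y_a+1, y_b) + δ(y_a, y_b+1)`. -/
theorem tmcmDelta_submodular
    (d : ℤ → ℝ)
    (hnonneg : ∀ y : ℤ, 0 ≤ d y)
    (hzero : d 0 = 0)
    (hsymm : ∀ y : ℤ, d y = d (-y))
    (hconv : ∀ y : ℤ, d (y + 1) - 2 * d y + d (y - 1) ≥ 0)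
    (M : ℝ) (hM : 0 ≤ M)
    (h' : ℤ) (hh' : 1 ≤ h')
    (xa xb : ℤ) :
    ∀ ya yb : ℤ, 0 ≤ ya → ya ≤ h' - 1 → 0 ≤ yb → yb ≤ h' - 1 →
      tmcmDelta d M xa xb ya yb + tmcmDelta d M xa xb (ya + 1) (yb + 1)
        ≤ tmcmDelta d M xa xb (ya + 1) yb + tmcmDelta d M xa xb ya (yb + 1) := by
  intro ya yb ha _ hb _
  have ha1 : ya + 1 ≠ 0 := by lia
  have hb1 : yb + 1 ≠ 0 := by lia
  unfold tmcmDelta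
  rcases eq_or_ne ya 0 with rfl | ha0 <;> rcases eq_or_ne yb 0 with rfl | hb0
  · have hmin := min_le_right (d (xa - xb)) M
    simp only [zero_add, one_ne_zero, if_true, if_false, sub_self, hzero]
    linarith
  · have h₁ := hsymm (yb - 1)
    have h₂ := hsymm yb
    rw [show -(yb - 1) = 0 + 1 - yb by ring] at h₁
    rw [show -yb = 0 + 1 - (yb + 1) by ring] at h₂
    simp only [hb0, ha1, hb1, if_true, if_false, add_sub_cancel_right]
    linarith
  · simp only [ha0, ha1, one_ne_zero, if_true, if_false, add_sub_cancel_right, zero_add]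
    linarith
  · have hc := hconv (ya - yb)
    rw [show ya - yb + 1 = ya + 1 - yb by ring,
      show ya - yb - 1 = ya - (yb + 1) by ring] at hc
    simp only [ha0, hb0, ha1, hb1, if_false, add_sub_add_right_eq_sub]
    linarith
end

section
/- Let k_1 ≤ k_2 ≤ … ≤ k_c be integers (c ≥ 2), let m be an integer with 1 ≤ m and 2m ≤ c, and for an integer i let a_i = #{p ∈ {1,…,c} : k_p ≤ i−1} and b_i = #{p ∈ {1,…,c} : k_p ≥ i}. Then ∑_{i=k_1+1}^{k_c} ∑_{j=i}^{k_c} min(a_i, b_j, m) · r_{ij} = ω · ∑_{t=1}^{m} d(k_{c−t+1} − k_t). (This is the statement that the clique graph construction exactly models clique potentials proportional to the sum of the m maximum convex distances over disjoint pairs of random variables.) -/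
/-- The second difference `d̄(i,j) = d(i-j+1) + d(i-j-1) - 2·d(i-j)`. -/
noncomputable def tmcmDBar (d : ℤ → ℝ) (i j : ℤ) : ℝ :=
  d (i - j + 1) + d (i - j - 1) - 2 * d (i - j)

/-- The arc capacity `r_{ij}`: `ω·d̄(i,j)/2` on the diagonal and `ω·d̄(i,j)`
off the diagonal. -/
noncomputable def tmcmR (d : ℤ → ℝ) (ω : ℝ) (i j : ℤ) : ℝ :=
  if i = j then ω * tmcmDBar d i j / 2 else ω * tmcmDBar d i j

/-- The capacities out of the row `i` telescope. -/
theorem sum_tmcmR_row (d : ℤ → ℝ) (hzero : d 0 = 0) (hsymm : ∀ y : ℤ, d y = d (-y))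
    (ω : ℝ) (i : ℤ) (n : ℕ) :
    ∑ j ∈ Finset.Icc i (i + n), tmcmR d ω i j = ω * (d (n + 1) - d n) := by
  induction n with
  | zero =>
    have h := hsymm (-1)
    norm_num at h
    simp [tmcmR, tmcmDBar, hzero, h]
    ring
  | succ n ih =>
    have hIcc : Finset.Icc i (i + (n + 1 : ℕ)) = insert (i + n + 1) (Finset.Icc i (i + n)) := by
      ext x
      simp only [Finset.mem_insert, Finset.mem_Icc]
      omega
    rw [hIcc, Finset.sum_insert (by simp [add_assoc]), ih, tmcmR, if_neg (by omega), tmcmDBar,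
      hsymm (i - (i + n + 1) + 1), hsymm (i - (i + n + 1) - 1), hsymm (i - (i + n + 1))]
    have h₁ : -(i - (i + n + 1) + 1) = (n : ℤ) := by ring
    have h₂ : -(i - (i + n + 1) - 1) = (n : ℤ) + 1 + 1 := by ring
    have h₃ : -(i - (i + n + 1)) = (n : ℤ) + 1 := by ring
    rw [h₁, h₂, h₃]
    push_cast
    ring

/-- The capacities over the triangle `y - n < i ≤ j ≤ y` add up to `ω * d n`. -/
theorem sum_tmcmR_triangle (d : ℤ → ℝ) (hzero : d 0 = 0) (hsymm : ∀ y : ℤ, d y = d (-y))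
    (ω : ℝ) (y : ℤ) (n : ℕ) :
    ∑ i ∈ Finset.Icc (y - n + 1) y, ∑ j ∈ Finset.Icc i y, tmcmR d ω i j = ω * d n := by
  induction n with
  | zero => simp [hzero]
  | succ n ih =>
    have hIcc : Finset.Icc (y - (n + 1 : ℕ) + 1) y
        = insert (y - n) (Finset.Icc (y - n + 1) y) := by
      ext x
      simp only [Finset.mem_insert, Finset.mem_Icc]
      omega
    have hrow := sum_tmcmR_row d hzero hsymm ω (y - n) n
    rw [sub_add_cancel] at hrow
    rw [hIcc, Finset.sum_insert (by simp), ih, hrow]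
    push_cast
    ring

/-- A triangle of capacities cut out of a larger one by an indicator. -/
theorem sum_ite_tmcmR (d : ℤ → ℝ) (hzero : d 0 = 0) (hsymm : ∀ y : ℤ, d y = d (-y))
    (ω : ℝ) {l u x y : ℤ} (hlx : l ≤ x) (hxy : x ≤ y) (hyu : y ≤ u) :
    ∑ i ∈ Finset.Icc (l + 1) u, ∑ j ∈ Finset.Icc i u,
        (if x < i ∧ j ≤ y then tmcmR d ω i j else 0) = ω * d (y - x) := by
  obtain ⟨n, hn⟩ := Int.eq_ofNat_of_zero_le (sub_nonneg.2 hxy)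
  have hx : x + 1 = y - n + 1 := by omega
  rw [hn, ← sum_tmcmR_triangle d hzero hsymm ω y n, ← hx]
  symm
  rw [← Finset.sum_subset (Finset.Icc_subset_Icc (by omega) hyu :
    Finset.Icc (x + 1) y ⊆ Finset.Icc (l + 1) u)]
  · refine Finset.sum_congr rfl fun i hi => ?_
    rw [Finset.mem_Icc] at hi
    rw [← Finset.sum_filter]
    refine Finset.sum_congr ?_ fun _ _ => rfl
    ext j
    simp only [Finset.mem_filter, Finset.mem_Icc]
    omega
  · intro i _ hi
    rw [Finset.mem_Icc] at hi
    refine Finset.sum_eq_zero fun j hj => if_neg ?_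
    rw [Finset.mem_Icc] at hj
    omega

/-- For sorted labels, at least `t` labels are at most `z` iff the `t`-th one is. -/
theorem le_card_filter_le_iff {c : ℕ} {k : ℕ → ℤ}
    (hsorted : ∀ p q : ℕ, 1 ≤ p → p ≤ q → q ≤ c → k p ≤ k q) {t : ℕ} (ht : 1 ≤ t) (htc : t ≤ c)
    (z : ℤ) : t ≤ ((Finset.Icc 1 c).filter (fun p => k p ≤ z)).card ↔ k t ≤ z := by
  constructor
  · intro h
    by_contra! hz
    have hsub : (Finset.Icc 1 c).filter (fun p => k p ≤ z) ⊆ Finset.Icc 1 (t - 1) := by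
      intro p hp
      simp only [Finset.mem_filter, Finset.mem_Icc] at hp ⊢
      by_contra hpt
      have := hsorted t p ht (by omega) hp.1.2
      omega
    have := Finset.card_le_card hsub
    rw [Nat.card_Icc] at this
    omega
  · intro h
    have hsub : Finset.Icc 1 t ⊆ (Finset.Icc 1 c).filter (fun p => k p ≤ z) := by
      intro p hp
      simp only [Finset.mem_filter, Finset.mem_Icc] at hp ⊢
      have := hsorted p t hp.1 hp.2 htc
      omega
    have := Finset.card_le_card hsub
    rw [Nat.card_Icc] at this
    omega

/-- For sorted labels, at least `t` labels are at least `z` iff the `t`-th largest one is. -/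
theorem le_card_filter_ge_iff {c : ℕ} {k : ℕ → ℤ}
    (hsorted : ∀ p q : ℕ, 1 ≤ p → p ≤ q → q ≤ c → k p ≤ k q) {t : ℕ} (ht : 1 ≤ t) (htc : t ≤ c)
    (z : ℤ) : t ≤ ((Finset.Icc 1 c).filter (fun p => z ≤ k p)).card ↔ z ≤ k (c - t + 1) := by
  constructor
  · intro h
    by_contra! hz
    have hsub : (Finset.Icc 1 c).filter (fun p => z ≤ k p) ⊆ Finset.Icc (c - t + 2) c := by
      intro p hp
      simp only [Finset.mem_filter, Finset.mem_Icc] at hp ⊢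
      by_contra hpt
      have := hsorted p (c - t + 1) hp.1.1 (by omega) (by omega)
      omega
    have := Finset.card_le_card hsub
    rw [Nat.card_Icc] at this
    omega
  · intro h
    have hsub : Finset.Icc (c - t + 1) c ⊆ (Finset.Icc 1 c).filter (fun p => z ≤ k p) := by
      intro p hp
      simp only [Finset.mem_filter, Finset.mem_Icc] at hp ⊢
      have := hsorted (c - t + 1) p (by omega) hp.1 hp.2
      omega
    have := Finset.card_le_card hsub
    rw [Nat.card_Icc] at this
    omega

/-- The minimum of three naturals as a sum of indicators. -/
theorem min_min_eq_sum_ite (a b m : ℕ) :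
    (min (min (a : ℝ) b) m) = ∑ t ∈ Finset.Icc 1 m, if t ≤ a ∧ t ≤ b then (1 : ℝ) else 0 := by
  have hIcc : (Finset.Icc 1 m).filter (fun t => t ≤ a ∧ t ≤ b)
      = Finset.Icc 1 (min (min a b) m) := by
    ext t
    simp only [Finset.mem_filter, Finset.mem_Icc]
    omega
  rw [Finset.sum_boole, hIcc, Nat.card_Icc, Nat.add_sub_cancel]
  push_cast
  rfl

/-- The clique graph construction exactly models the sum of the `m` maximum
convex distances over disjoint pairs: with sorted labels `k_1 ≤ … ≤ k_c`,
`a_i = #{p : k_p ≤ i-1}` and `b_j = #{p : k_p ≥ j}`, one has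
`∑_{i=k_1+1}^{k_c} ∑_{j=i}^{k_c} min(a_i, b_j, m) · r_{ij}
  = ω · ∑_{t=1}^{m} d(k_{c-t+1} - k_t)`. -/
theorem sum_min_tmcmR_eq_sum_max_convex
    (d : ℤ → ℝ)
    (hnonneg : ∀ y : ℤ, 0 ≤ d y)
    (hzero : d 0 = 0)
    (hsymm : ∀ y : ℤ, d y = d (-y))
    (hconv : ∀ y : ℤ, d (y + 1) - 2 * d y + d (y - 1) ≥ 0)
    (ω : ℝ) (hω : 0 ≤ ω)
    (c : ℕ) (hc : 2 ≤ c)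
    (k : ℕ → ℤ)
    (hsorted : ∀ p q : ℕ, 1 ≤ p → p ≤ q → q ≤ c → k p ≤ k q)
    (m : ℕ) (hm : 1 ≤ m) (hmc : 2 * m ≤ c)
    (a b : ℤ → ℕ)
    (ha : ∀ i : ℤ, a i = ((Finset.Icc 1 c).filter (fun p => k p ≤ i - 1)).card)
    (hb : ∀ j : ℤ, b j = ((Finset.Icc 1 c).filter (fun p => j ≤ k p)).card) :
    ∑ i ∈ Finset.Icc (k 1 + 1) (k c), ∑ j ∈ Finset.Icc i (k c),
        (min (min (a i) (b j)) m : ℝ) * tmcmR d ω i j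
      = ω * ∑ t ∈ Finset.Icc 1 m, d (k (c - t + 1) - k t) := by
  have hterm : ∀ i j : ℤ, (min (min (a i) (b j)) m : ℝ) * tmcmR d ω i j
      = ∑ t ∈ Finset.Icc 1 m,
          if k t < i ∧ j ≤ k (c - t + 1) then tmcmR d ω i j else 0 := by
    intro i j
    rw [min_min_eq_sum_ite, Finset.sum_mul]
    refine Finset.sum_congr rfl fun t ht => ?_
    rw [Finset.mem_Icc] at ht
    simp only [ha, hb, le_card_filter_le_iff hsorted ht.1 (show t ≤ c by omega),
      le_card_filter_ge_iff hsorted ht.1 (show t ≤ c by omega), ite_mul, one_mul,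
      zero_mul, ← Int.le_sub_one_iff (m := k t)]
  simp only [hterm]
  rw [Finset.sum_congr rfl fun i _ => Finset.sum_comm, Finset.sum_comm, Finset.mul_sum]
  refine Finset.sum_congr rfl fun t ht => ?_
  rw [Finset.mem_Icc] at ht
  exact sum_ite_tmcmR d hzero hsymm ω (hsorted _ _ le_rfl ht.1 (by omega))
    (hsorted _ _ ht.1 (by omega) (by omega)) (hsorted _ _ (by omega) (by omega) le_rfl)
end

section
/- Let c ≥ 2, L ≥ 1 and M ≥ 1 be integers, and let l_1 ≤ l_2 ≤ … ≤ l_c be integers with r = l_c − l_1 satisfying M ≤ r ≤ L. Then ∑_{i=l_c−L}^{l_1−1} (l_c − l_1) + ∑_{p=1}^{c−1} ∑_{i=l_p−L}^{l_{p+1}−L−1} (M + l_p − (i+1)) + ∑_{i=l_1}^{l_c−1} (M + l_c − (i+1)) ≤ L·(2L + 2M − 1 − (c·L)/(2(c−1))). -/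
/-- An arithmetic progression with difference `-1`, summed over a half-open integer interval. -/
lemma sum_Icc_sub_succ (K : ℚ) {a b : ℤ} (hab : a ≤ b) :
    ∑ i ∈ Finset.Icc a (b - 1), (K - ((i : ℚ) + 1))
      = ((b : ℚ) - a) * (K - ((a : ℚ) + b + 1) / 2) := by
  induction b, hab using Int.leInduction with
  | base => simp
  | succ n hn ih =>
    have h : Finset.Icc a (n + 1 - 1) = insert n (Finset.Icc a (n - 1)) := by
      ext x
      simp only [Finset.mem_Icc, Finset.mem_insert]
      omega
    rw [h, Finset.sum_insert (by simp), ih]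
    push_cast
    ring

lemma sum_Icc_one_sub_telescope (f : ℕ → ℚ) (n : ℕ) :
    ∑ p ∈ Finset.Icc 1 n, (f (p + 1) - f p) = f (n + 1) - f 1 := by
  induction n with
  | zero => simp
  | succ n ih => rw [Finset.sum_Icc_succ_top (by omega), ih]; ring

/-- Case II bound: with sorted labels `l_1 ≤ … ≤ l_c`, `r = l_c - l_1` and
`M ≤ r ≤ L` (with `c ≥ 2`, `L ≥ 1`, `M ≥ 1`),
`A + B + C ≤ L·(2L + 2M - 1 - (c·L)/(2(c-1)))` where
`A = ∑_{i=l_c-L}^{l_1-1} (l_c - l_1)`,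
`B = ∑_{p=1}^{c-1} ∑_{i=l_p-L}^{l_{p+1}-L-1} (M + l_p - (i+1))` and
`C = ∑_{i=l_1}^{l_c-1} (M + l_c - (i+1))`, as rational numbers. -/
theorem sum_ABC_le_caseII
    (c : ℕ) (hc : 2 ≤ c)
    (L M : ℤ) (hL : 1 ≤ L) (hM : 1 ≤ M)
    (l : ℕ → ℤ)
    (hsorted : ∀ p q : ℕ, 1 ≤ p → p ≤ q → q ≤ c → l p ≤ l q)
    (hMr : M ≤ l c - l 1) (hrL : l c - l 1 ≤ L) :
    (∑ i ∈ Finset.Icc (l c - L) (l 1 - 1), ((l c : ℚ) - (l 1 : ℚ)))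
      + (∑ p ∈ Finset.Icc 1 (c - 1), ∑ i ∈ Finset.Icc (l p - L) (l (p + 1) - L - 1),
          ((M : ℚ) + (l p : ℚ) - ((i : ℚ) + 1)))
      + (∑ i ∈ Finset.Icc (l 1) (l c - 1), ((M : ℚ) + (l c : ℚ) - ((i : ℚ) + 1)))
      ≤ (L : ℚ) * (2 * (L : ℚ) + 2 * (M : ℚ) - 1
          - (c : ℚ) * (L : ℚ) / (2 * ((c : ℚ) - 1))) := by
  obtain ⟨n, rfl⟩ : ∃ n, c = n + 1 := ⟨c - 1, by omega⟩
  simp only [Nat.add_sub_cancel]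
  have hn : (1 : ℚ) ≤ n := by exact_mod_cast (by omega : 1 ≤ n)
  have hA : ∑ i ∈ Finset.Icc (l (n + 1) - L) (l 1 - 1), ((l (n + 1) : ℚ) - (l 1 : ℚ))
      = (L - ((l (n + 1) : ℚ) - l 1)) * ((l (n + 1) : ℚ) - l 1) := by
    have hcard : (((l 1 - 1 + 1 - (l (n + 1) - L)).toNat : ℤ) : ℚ)
        = L - ((l (n + 1) : ℚ) - l 1) := by
      rw [Int.toNat_of_nonneg (by omega)]
      push_cast
      ring
    rw [Finset.sum_const, Int.card_Icc, nsmul_eq_mul, ← hcard, Int.cast_natCast]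
  have hB : ∑ p ∈ Finset.Icc 1 n, ∑ i ∈ Finset.Icc (l p - L) (l (p + 1) - L - 1),
          ((M : ℚ) + (l p : ℚ) - ((i : ℚ) + 1))
      = ((M : ℚ) + L - 1 / 2) * ((l (n + 1) : ℚ) - l 1)
        - (∑ p ∈ Finset.Icc 1 n, ((l (p + 1) : ℚ) - l p) ^ 2) / 2 := by
    rw [← sum_Icc_one_sub_telescope (fun p => (l p : ℚ)), Finset.mul_sum, Finset.sum_div,
      ← Finset.sum_sub_distrib]
    refine Finset.sum_congr rfl fun p hp => ?_
    rw [Finset.mem_Icc] at hp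
    have := hsorted p (p + 1) hp.1 (by omega) (by omega)
    rw [sum_Icc_sub_succ _ (by omega)]
    push_cast
    ring
  have hS : ((l (n + 1) : ℚ) - l 1) ^ 2
      ≤ n * ∑ p ∈ Finset.Icc 1 n, ((l (p + 1) : ℚ) - l p) ^ 2 := by
    have := sq_sum_le_card_mul_sum_sq (s := Finset.Icc 1 n)
      (f := fun p => (l (p + 1) : ℚ) - l p)
    rwa [sum_Icc_one_sub_telescope (fun p => (l p : ℚ)), Nat.card_Icc,
      Nat.add_sub_cancel] at this
  rw [hA, hB, sum_Icc_sub_succ _ (by omega)]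
  have hrL' : (l (n + 1) : ℚ) - l 1 ≤ L := by exact_mod_cast hrL
  have hM' : (1 : ℚ) ≤ M := by exact_mod_cast hM
  have hL' : (1 : ℚ) ≤ L := by exact_mod_cast hL
  obtain ⟨r, hr⟩ : ∃ r : ℚ, r = (l (n + 1) : ℚ) - l 1 := ⟨_, rfl⟩
  rw [← hr] at hS hrL' ⊢
  rw [← div_le_iff₀' (by linarith)] at hS
  have hk : ((n + 1 : ℕ) : ℚ) * L / (2 * (((n + 1 : ℕ) : ℚ) - 1)) = L / 2 + L * (1 / n) / 2 := by
    have hn0 : (n : ℚ) ≠ 0 := by positivity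
    push_cast
    rw [add_sub_cancel_right]
    field_simp
  have hinv : 1 / (n : ℚ) ≤ 1 := (div_le_one (by linarith)).2 hn
  have hinv0 : 0 ≤ 1 / (n : ℚ) := by positivity
  rw [hk]
  rw [div_eq_mul_one_div] at hS
  generalize 1 / (n : ℚ) = t at *
  have hl : (l (n + 1) : ℚ) = l 1 + r := by linarith
  rw [hl]
  have hfactor : 0 ≤ 2 * (L : ℚ) + 2 * M - 1 - (1 + t) / 2 * (L + r) := by
    have h1 : (1 + t) / 2 * (L + r) ≤ (1 + t) / 2 * (2 * L) := by gcongr; linarith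
    nlinarith
  have := mul_nonneg (sub_nonneg.2 hrL') hfactor
  linarith
end

section
/- Let c ≥ 2 be an integer, let l_1 ≤ l_2 ≤ … ≤ l_c be integers, let M and L be integers with 1 ≤ M ≤ L, and let ω ≥ 0 be a real number. Set θ = ω·min(l_c − l_1, M). For each integer i, let N_i = {p ∈ {1,…,c} : i + 1 ≤ l_p ≤ i + L}, and define g(i) = ω·(l_c − l_1) if N_i = {1,…,c}; g(i) = ω·(M + max{l_p : p ∈ N_i} − (i+1)) if N_i is nonempty and N_i ≠ {1,…,c}; and g(i) = 0 if N_i is empty. Then g(i) = 0 for i outside [l_1 − L, l_c − 1], and ∑_{i ∈ ℤ} g(i) ≤ L · max{(c/2)·(2 + L/M), 2 + 2M/L} · θ. (This is the per-clique form of the key inequality for the truncated max-of-linear model with m = 1, where the first branch corresponds to intervals in which all clique variables take their optimal labels and the second branch to intervals in which some but not all do.) -/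
/-- `N i` is the set of indices `p ∈ {1,…,c}` whose label `l p` lies in the
interval `[i+1, i+L]` of `L` consecutive labels. -/
def tmcmN (c : ℕ) (l : ℕ → ℤ) (L : ℤ) (i : ℤ) : Finset ℕ :=
  (Finset.Icc 1 c).filter (fun p => i + 1 ≤ l p ∧ l p ≤ i + L)

/-- The contribution `g i` of the interval `[i+1, i+L]`: `ω·(l_c - l_1)` if all
clique variables take a label in the interval, `ω·(M + max{l_p in interval} - (i+1))`
if some but not all do, and `0` otherwise. -/
noncomputable def tmcmG (c : ℕ) (l : ℕ → ℤ) (L M : ℤ) (ω : ℝ) (i : ℤ) : ℝ :=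
  if tmcmN c l L i = Finset.Icc 1 c then
    ω * ((l c - l 1 : ℤ) : ℝ)
  else if h : (tmcmN c l L i).Nonempty then
    ω * ((M + (tmcmN c l L i).sup' h l - (i + 1) : ℤ) : ℝ)
  else 0

theorem mem_tmcmN {c : ℕ} {l : ℕ → ℤ} {L i : ℤ} {p : ℕ} :
    p ∈ tmcmN c l L i ↔ (1 ≤ p ∧ p ≤ c) ∧ i + 1 ≤ l p ∧ l p ≤ i + L := by
  simp [tmcmN]

/-- To bound `g i` it suffices to bound each of its three branches; in the second one the maximal
label of the interval is attained. -/
theorem tmcmG_le {c : ℕ} {l : ℕ → ℤ} {L M : ℤ} {ω : ℝ} (hω : 0 ≤ ω) {i k : ℤ}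
    (hfull : tmcmN c l L i = Finset.Icc 1 c → l c - l 1 ≤ k)
    (hpart : tmcmN c l L i ≠ Finset.Icc 1 c → ∀ p ∈ tmcmN c l L i, M + l p - (i + 1) ≤ k)
    (hk : 0 ≤ k) : tmcmG c l L M ω i ≤ ω * (k : ℝ) := by
  unfold tmcmG
  split_ifs with h₁ h₂
  · exact mul_le_mul_of_nonneg_left (by exact_mod_cast hfull h₁) hω
  · obtain ⟨p, hp, hsup⟩ := Finset.exists_mem_eq_sup' h₂ l
    rw [hsup]
    exact mul_le_mul_of_nonneg_left (by exact_mod_cast hpart h₁ p hp) hω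
  · exact mul_nonneg hω (by exact_mod_cast hk)

theorem tmcmG_eq_zero {c : ℕ} (hc : 1 ≤ c) {l : ℕ → ℤ} {L M : ℤ} {ω : ℝ} {i : ℤ}
    (h : tmcmN c l L i = ∅) : tmcmG c l L M ω i = 0 := by
  have hne : (∅ : Finset ℕ) ≠ Finset.Icc 1 c := (Finset.nonempty_Icc.2 hc).ne_empty.symm
  simp [tmcmG, h, hne]

theorem two_mul_sum_Ico_sub (M a : ℤ) (n : ℕ) :
    2 * ∑ i ∈ Finset.Ico (a - n) a, (M + a - (i + 1)) = n * (2 * M + n - 1) := by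
  induction n with
  | zero => simp
  | succ n ih =>
    have hins : Finset.Ico (a - (n + 1 : ℕ)) a
        = insert (a - (n + 1 : ℕ)) (Finset.Ico (a - n) a) := by
      ext x
      simp only [Finset.mem_Ico, Finset.mem_insert]
      omega
    rw [hins, Finset.sum_insert (by simp; omega), mul_add, ih]
    push_cast
    ring

/-- Charging every interval to all the labels it contains. -/
theorem sum_tmcmG_le_of_le {c : ℕ} (hc : 2 ≤ c) {l : ℕ → ℤ}
    (hsorted : ∀ p q : ℕ, 1 ≤ p → p ≤ q → q ≤ c → l p ≤ l q)
    {M L : ℤ} (hM : 0 ≤ M) (hL : 0 ≤ L) {ω : ℝ} (hω : 0 ≤ ω) :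
    2 * ∑ i ∈ Finset.Icc (l 1 - L) (l c - 1), tmcmG c l L M ω i
      ≤ ω * ((c * (L * (2 * M + L - 1)) : ℤ) : ℝ) := by
  have hpt : ∀ i ∈ Finset.Icc (l 1 - L) (l c - 1), tmcmG c l L M ω i
      ≤ ω * ((∑ p ∈ tmcmN c l L i, (M + l p - (i + 1)) : ℤ) : ℝ) := by
    intro i _
    have hnn : ∀ p ∈ tmcmN c l L i, 0 ≤ M + l p - (i + 1) := fun p hp => by
      have := (mem_tmcmN.1 hp).2
      omega
    refine tmcmG_le hω (fun hfull => ?_)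
      (fun _ p hp => Finset.single_le_sum (f := fun p => M + l p - (i + 1)) hnn hp)
      (Finset.sum_nonneg hnn)
    have h1 : 1 ∈ tmcmN c l L i := by rw [hfull]; simp; omega
    have hcm : c ∈ tmcmN c l L i := by rw [hfull]; simp; omega
    have := Finset.single_le_sum (f := fun p => M + l p - (i + 1)) hnn hcm
    have := (mem_tmcmN.1 h1).2
    omega
  have hswap : ∑ i ∈ Finset.Icc (l 1 - L) (l c - 1), ∑ p ∈ tmcmN c l L i, (M + l p - (i + 1))
      = ∑ p ∈ Finset.Icc 1 c, ∑ i ∈ Finset.Ico (l p - L) (l p), (M + l p - (i + 1)) := by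
    refine Finset.sum_comm' fun i p => ?_
    simp only [mem_tmcmN, Finset.mem_Icc, Finset.mem_Ico]
    constructor
    · omega
    · rintro ⟨hi, hp⟩
      have := hsorted 1 p le_rfl hp.1 hp.2
      have := hsorted p c hp.1 hp.2 le_rfl
      omega
  have hsum : 2 * ∑ i ∈ Finset.Icc (l 1 - L) (l c - 1),
      ∑ p ∈ tmcmN c l L i, (M + l p - (i + 1)) = c * (L * (2 * M + L - 1)) := by
    lift L to ℕ using hL
    rw [hswap, Finset.mul_sum, Finset.sum_congr rfl fun p _ => two_mul_sum_Ico_sub M (l p) L]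
    simp
  have hle := Finset.sum_le_sum hpt
  rw [← Finset.mul_sum, ← Int.cast_sum] at hle
  rw [← hsum, Int.cast_mul, Int.cast_ofNat]
  linarith

/-- Counting the intervals that miss `l c`, that miss `l 1`, and that contain all labels. -/
theorem sum_tmcmG_le_of_spread_le {c : ℕ} (hc : 1 ≤ c) {l : ℕ → ℤ}
    (hsorted : ∀ p q : ℕ, 1 ≤ p → p ≤ q → q ≤ c → l p ≤ l q)
    {M L : ℤ} (hM : 0 ≤ M) (hL : l c - l 1 ≤ L) {ω : ℝ} (hω : 0 ≤ ω) :
    ∑ i ∈ Finset.Icc (l 1 - L) (l c - 1), tmcmG c l L M ω i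
      ≤ ω * (((l c - l 1) * (2 * L + 2 * M) : ℤ) : ℝ) := by
  have h1c := hsorted 1 c le_rfl hc le_rfl
  have hpt : ∀ i ∈ Finset.Icc (l 1 - L) (l c - 1), tmcmG c l L M ω i
      ≤ ω * (((l c - l 1) + (if i < l c - L then M + L - (l c - l 1) else 0)
          + (if l 1 ≤ i then M else 0) : ℤ) : ℝ) := by
    intro i _
    refine tmcmG_le hω (fun _ => ?_) (fun hne p hp => ?_) ?_
    · split_ifs <;> omega
    · have hor : i < l c - L ∨ l 1 ≤ i := by
        by_contra! hcon
        refine hne (Finset.ext fun q => ?_)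
        rw [mem_tmcmN, Finset.mem_Icc]
        refine ⟨fun h => h.1, fun hq => ⟨hq, ?_⟩⟩
        have := hsorted 1 q le_rfl hq.1 hq.2
        have := hsorted q c hq.1 hq.2 le_rfl
        omega
      obtain ⟨hpc, hpi⟩ := mem_tmcmN.1 hp
      have := hsorted p c hpc.1 hpc.2 le_rfl
      split_ifs <;> omega
    · split_ifs <;> omega
  have hleft : (Finset.Icc (l 1 - L) (l c - 1)).filter (fun i => i < l c - L)
      = Finset.Ico (l 1 - L) (l c - L) := by
    ext i
    simp only [Finset.mem_filter, Finset.mem_Icc, Finset.mem_Ico]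
    omega
  have hright : (Finset.Icc (l 1 - L) (l c - 1)).filter (fun i => l 1 ≤ i)
      = Finset.Ico (l 1) (l c) := by
    ext i
    simp only [Finset.mem_filter, Finset.mem_Icc, Finset.mem_Ico]
    omega
  have hsum : ∑ i ∈ Finset.Icc (l 1 - L) (l c - 1),
      ((l c - l 1) + (if i < l c - L then M + L - (l c - l 1) else 0)
        + (if l 1 ≤ i then M else 0)) = (l c - l 1) * (2 * L + 2 * M) := by
    rw [Finset.sum_add_distrib, Finset.sum_add_distrib, ← Finset.sum_filter, ← Finset.sum_filter,
      hleft, hright]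
    simp only [Finset.sum_const, Int.card_Icc, Int.card_Ico, nsmul_eq_mul]
    rw [Int.toNat_of_nonneg (by omega), Int.toNat_of_nonneg (by omega),
      Int.toNat_of_nonneg (by omega)]
    ring
  have hle := Finset.sum_le_sum hpt
  rwa [← Finset.mul_sum, ← Int.cast_sum, hsum] at hle

/-- Per-clique key inequality for the truncated max-of-linear model (`m = 1`):
`g` vanishes outside `[l_1 - L, l_c - 1]` and
`∑_{i ∈ ℤ} g(i) ≤ L · max{(c/2)·(2 + L/M), 2 + 2M/L} · θ`
where `θ = ω·min(l_c - l_1, M)`. -/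
theorem per_clique_key_inequality
    (c : ℕ) (hc : 2 ≤ c)
    (l : ℕ → ℤ)
    (hsorted : ∀ p q : ℕ, 1 ≤ p → p ≤ q → q ≤ c → l p ≤ l q)
    (M L : ℤ) (hM : 1 ≤ M) (hML : M ≤ L)
    (ω : ℝ) (hω : 0 ≤ ω) :
    (∀ i : ℤ, (i < l 1 - L ∨ l c - 1 < i) → tmcmG c l L M ω i = 0) ∧
    ∑ i ∈ Finset.Icc (l 1 - L) (l c - 1), tmcmG c l L M ω i
      ≤ (L : ℝ) * max (((c : ℝ) / 2) * (2 + (L : ℝ) / (M : ℝ)))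
            (2 + 2 * (M : ℝ) / (L : ℝ))
          * (ω * ((min (l c - l 1) M : ℤ) : ℝ)) := by
  have h1c := hsorted 1 c le_rfl (by omega) le_rfl
  have hMR : (0 : ℝ) < M := by exact_mod_cast hM
  have hLR : (0 : ℝ) < L := by exact_mod_cast hM.trans hML
  refine ⟨fun i hi => tmcmG_eq_zero (by omega) (Finset.eq_empty_of_forall_notMem fun p hp => ?_), ?_⟩
  · obtain ⟨hpc, hpi⟩ := mem_tmcmN.1 hp
    have := hsorted 1 p le_rfl hpc.1 hpc.2
    have := hsorted p c hpc.1 hpc.2 le_rfl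
    omega
  rcases le_total (l c - l 1) M with hD | hD
  · rw [min_eq_left hD]
    have hθ : 0 ≤ ω * ((l c - l 1 : ℤ) : ℝ) :=
      mul_nonneg hω (by exact_mod_cast sub_nonneg.2 h1c)
    calc _ ≤ ω * (((l c - l 1) * (2 * L + 2 * M) : ℤ) : ℝ) :=
          sum_tmcmG_le_of_spread_le (by omega) hsorted (by omega) (by omega) hω
      _ = (L : ℝ) * (2 + 2 * (M : ℝ) / (L : ℝ)) * (ω * ((l c - l 1 : ℤ) : ℝ)) := by
          push_cast
          field_simp
      _ ≤ _ := by
          gcongr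
          exact le_max_right _ _
  · rw [min_eq_right hD]
    have hsum := sum_tmcmG_le_of_le hc hsorted (M := M) (L := L) (by omega) (by omega) hω
    have hcL : 0 ≤ ω * ((c : ℝ) * L) := by positivity
    calc _ ≤ ω * ((c : ℝ) * L * (2 * M + L)) / 2 := by
          push_cast at hsum
          linarith
      _ = (L : ℝ) * (((c : ℝ) / 2) * (2 + (L : ℝ) / (M : ℝ))) * (ω * (M : ℝ)) := by
          field_simp
      _ ≤ _ := by
          gcongr
          exact le_max_left _ _
end
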